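/- Let 1 ≤ s ≤ t be integers, let q be a prime power, and set r = t(q + 1). Then there exists an (r,t)-graph H with τ_s(H) ≥ s·q = s·(r/t − 1). -/

import Mathlib

/-- `E` is the edge set of an `r`-uniform `r`-partite hypergraph on vertex type `V`
with parts given by the fibres of `part`: each edge contains exactly one vertex
from each of the `r` parts. -/
def IsRPartite {V : Type} (r : ℕ) (part : V → Fin r) (E : Finset (Finset V)) : Prop :=
  ∀ e ∈ E, ∀ j : Fin r, (e.filter (fun v => part v = j)).card = 1

/-- The hypergraph with edge set `E` is `t`-intersecting. -/
def IntersectingGe {V : Type} (t : ℕ) (E : Finset (Finset V)) : Prop :=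
  ∀ e ∈ E, ∀ f ∈ E, t ≤ ((↑e ∩ ↑f : Set V)).ncard

/-- `C` is a vertex cover of the hypergraph with edge set `E`. -/
def IsCover {V : Type} (E : Finset (Finset V)) (C : Finset V) : Prop :=
  ∀ e ∈ E, ∃ v ∈ e, v ∈ C

/-- The cover number: the minimum size of a vertex cover. -/
noncomputable def coverNumber {V : Type} (E : Finset (Finset V)) : ℕ :=
  sInf {n | ∃ C : Finset V, IsCover E C ∧ C.card = n}

/-- `B` is an `s`-cover of the hypergraph with edge set `E`: it meets every edge
in at least `s` vertices. -/
def IsSCover {V : Type} (s : ℕ) (E : Finset (Finset V)) (B : Finset V) : Prop :=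
  ∀ e ∈ E, s ≤ ((↑e ∩ ↑B : Set V)).ncard

/-- The `s`-cover number: the minimum size of an `s`-cover. -/
noncomputable def sCoverNumber {V : Type} (s : ℕ) (E : Finset (Finset V)) : ℕ :=
  sInf {n | ∃ B : Finset V, IsSCover s E B ∧ B.card = n}

/-- The height above the point `o` of the projective line of the graph of `x ↦ a * x + b`,
where the height at infinity is the slope. -/
def lineHeight {F : Type} [Field F] (p : F × F) : Option F → F
  | none => p.1
  | some x => p.1 * x + p.2

/-- The edge `p` consists of `t` disjoint copies of the line `p` of a truncated projective
plane. -/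
noncomputable def truncatedLine {F : Type} [Field F] [Fintype F] (t : ℕ) (p : F × F) :
    Finset (Fin t × Option F × F) := by
  classical exact Finset.univ.filter fun v => v.2.2 = lineHeight p v.2.1

section

variable {F : Type} [Field F]

theorem exists_lineHeight_eq (p p' : F × F) : ∃ o, lineHeight p o = lineHeight p' o := by
  by_cases h : p.1 = p'.1
  · exact ⟨none, h⟩
  · have h' : p.1 - p'.1 ≠ 0 := sub_ne_zero.mpr h
    refine ⟨some ((p'.2 - p.2) / (p.1 - p'.1)), ?_⟩
    simp only [lineHeight]
    field_simp
    ring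

variable [Fintype F]

theorem mem_truncatedLine {t : ℕ} {p : F × F} {v : Fin t × Option F × F} :
    v ∈ truncatedLine t p ↔ v.2.2 = lineHeight p v.2.1 := by
  simp [truncatedLine]

theorem le_ncard_truncatedLine_inter (t : ℕ) (p p' : F × F) :
    t ≤ ((↑(truncatedLine t p) ∩ ↑(truncatedLine t p') :
      Set (Fin t × Option F × F))).ncard := by
  classical
  obtain ⟨o, ho⟩ := exists_lineHeight_eq p p'
  rw [← Finset.coe_inter, Set.ncard_coe_finset]
  calc t = (Finset.univ.image fun i : Fin t => (i, o, lineHeight p o)).card := by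
        rw [Finset.card_image_of_injective _ fun i j h => congrArg Prod.fst h]
        simp
    _ ≤ _ := Finset.card_le_card fun v hv => by
        obtain ⟨i, -, rfl⟩ := Finset.mem_image.mp hv
        simp [mem_truncatedLine, ho]

theorem card_filter_lineHeight_le [DecidableEq F] (o : Option F) (y : F) :
    (Finset.univ.filter fun p : F × F => y = lineHeight p o).card ≤ Fintype.card F := by
  rw [← Finset.card_univ]
  cases o with
  | none =>
    refine Finset.card_le_card_of_injOn Prod.snd (by simp) fun p hp p' hp' h => ?_
    replace hp : y = lineHeight p none := by simpa using hp
    replace hp' : y = lineHeight p' none := by simpa using hp'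
    exact Prod.ext (hp.symm.trans hp') h
  | some x =>
    refine Finset.card_le_card_of_injOn Prod.fst (by simp) fun p hp p' hp' h => ?_
    replace hp : y = lineHeight p (some x) := by simpa using hp
    replace hp' : y = lineHeight p' (some x) := by simpa using hp'
    refine Prod.ext h (add_left_cancel (a := p.1 * x) ?_)
    calc p.1 * x + p.2 = p'.1 * x + p'.2 := hp.symm.trans hp'
      _ = p.1 * x + p'.2 := by rw [show p.1 = p'.1 from h]

theorem mul_card_le_card_of_le_ncard {s t : ℕ} {B : Finset (Fin t × Option F × F)}
    (hB : ∀ p : F × F, s ≤ ((↑(truncatedLine t p) ∩ ↑B :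
      Set (Fin t × Option F × F))).ncard) :
    s * Fintype.card F ≤ B.card := by
  classical
  have hB' (p : F × F) : s ≤ (B.filter fun v => v.2.2 = lineHeight p v.2.1).card := by
    refine (hB p).trans_eq ?_
    rw [← Finset.coe_inter, Set.ncard_coe_finset]
    congr 1
    ext v
    simp [mem_truncatedLine, and_comm]
  refine Nat.le_of_mul_le_mul_right ?_ (Fintype.card_pos (α := F))
  calc s * Fintype.card F * Fintype.card F = ∑ _p : F × F, s := by
        simp [Fintype.card_prod]; ring
    _ ≤ ∑ p : F × F, (B.filter fun v => v.2.2 = lineHeight p v.2.1).card :=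
        Finset.sum_le_sum fun p _ => hB' p
    _ = ∑ v ∈ B, (Finset.univ.filter fun p : F × F => v.2.2 = lineHeight p v.2.1).card :=
        (Finset.sum_card_bipartiteAbove_eq_sum_card_bipartiteBelow
          (fun (v : Fin t × Option F × F) (p : F × F) => v.2.2 = lineHeight p v.2.1)).symm
    _ ≤ ∑ _v ∈ B, Fintype.card F :=
        Finset.sum_le_sum fun v _ => card_filter_lineHeight_le v.2.1 v.2.2
    _ = B.card * Fintype.card F := by simp

theorem card_truncatedLine_filter {t r : ℕ} (φ : Fin t × Option F ≃ Fin r) (p : F × F)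
    (j : Fin r) :
    ((truncatedLine t p).filter fun v => φ (v.1, v.2.1) = j).card = 1 := by
  refine Finset.card_eq_one.mpr
    ⟨((φ.symm j).1, (φ.symm j).2, lineHeight p (φ.symm j).2), ?_⟩
  ext ⟨i, o, y⟩
  simp only [Finset.mem_filter, mem_truncatedLine, Finset.mem_singleton,
    ← φ.eq_symm_apply, Prod.ext_iff]
  constructor
  · rintro ⟨rfl, rfl, rfl⟩
    exact ⟨rfl, rfl, rfl⟩
  · rintro ⟨rfl, rfl, rfl⟩
    exact ⟨rfl, rfl, rfl⟩

end

theorem le_ncard_inter_univ_of_isRPartite {V : Type} [Fintype V] {r : ℕ} {part : V → Fin r}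
    {E : Finset (Finset V)} (hE : IsRPartite r part E) {e : Finset V} (he : e ∈ E) :
    r ≤ ((↑e ∩ ↑(Finset.univ : Finset V) : Set V)).ncard := by
  rw [Finset.coe_univ, Set.inter_univ, Set.ncard_coe_finset,
    Finset.card_eq_sum_card_fiberwise (f := part) (t := Finset.univ) (by simp),
    Finset.sum_congr rfl fun j _ => hE e he j]
  simp

/-- **Proposition 3.10**: let `1 ≤ s ≤ t`, let `q` be a prime power and
`r = t(q + 1)`. Then there is an `(r,t)`-graph `H` with `τ_s(H) ≥ s q = s (r/t - 1)`. -/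
theorem exists_rt_graph_sCover_ge_sq (s t q r : ℕ)
    (hs : 1 ≤ s) (hst : s ≤ t) (hq : IsPrimePow q) (hr : r = t * (q + 1)) :
    ∃ (V : Type) (_ : Fintype V) (part : V → Fin r) (E : Finset (Finset V)),
      IsRPartite r part E ∧ IntersectingGe t E ∧
      s * q ≤ sCoverNumber s E := by
  classical
  obtain ⟨F, _, _, rfl⟩ : ∃ (F : Type) (_ : Field F) (_ : Fintype F), Fintype.card F = q := by
    obtain ⟨hF⟩ := (Fintype.nonempty_field_iff (α := Fin q)).mpr (by simpa using hq)
    exact ⟨Fin q, hF, inferInstance, Fintype.card_fin q⟩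
  let φ : Fin t × Option F ≃ Fin r := Fintype.equivFinOfCardEq (by simp [hr])
  have hpart : IsRPartite r (fun v : Fin t × Option F × F => φ (v.1, v.2.1))
      (Finset.univ.image (truncatedLine t)) := by
    intro e he j
    obtain ⟨p, -, rfl⟩ := Finset.mem_image.mp he
    exact card_truncatedLine_filter φ p j
  refine ⟨Fin t × Option F × F, inferInstance, _, _, hpart, ?_, ?_⟩
  · intro e he f hf
    obtain ⟨p, -, rfl⟩ := Finset.mem_image.mp he
    obtain ⟨p', -, rfl⟩ := Finset.mem_image.mp hf
    exact le_ncard_truncatedLine_inter t p p'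
  · refine le_csInf ⟨_, Finset.univ, fun e he => ?_, rfl⟩ ?_
    · have hsr : s ≤ r := hst.trans (hr ▸ Nat.le_mul_of_pos_right t (Nat.succ_pos _))
      exact hsr.trans (le_ncard_inter_univ_of_isRPartite hpart he)
    · rintro _ ⟨B, hB, rfl⟩
      exact mul_card_le_card_of_le_ncard fun p =>
        hB _ (Finset.mem_image_of_mem _ (Finset.mem_univ p))
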